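/- arXiv:1703.02736 — 2 statements merged into one kernel-verified Lean document; each statement's English description precedes it below -/
import Mathlib

section
/- Let φ : ℝ → ℝ be convex on the interval [0,1] with φ(0) = 0, and for each integer j ≥ 1 set λ_j = φ(1/j); assume λ_j ≥ 0 for all j ≥ 1. Then for all integers j, m with 1 ≤ j ≤ m, one has λ_j − λ_{j+1} ≥ λ_m − λ_{m+1} ≥ λ_m/(m+1) ≥ λ_m/(2m). In particular the eigenvalue gaps are uniformly bounded below: λ_j − λ_{j+1} ≥ λ_m/(2m) for all 1 ≤ j ≤ m. -/
/-- If `φ` is convex on `[0,1]` and vanishes at `0`, then `φ (1/n) / (n+1)` is at most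
`φ (1/n) - φ (1/(n+1))`. -/
theorem ConvexOn.div_succ_le_sub_inv_succ {φ : ℝ → ℝ} (hφ : ConvexOn ℝ (Set.Icc (0 : ℝ) 1) φ)
    (hφ0 : φ 0 = 0) {n : ℕ} (hn : 1 ≤ n) :
    φ (1 / (n : ℝ)) / ((n : ℝ) + 1) ≤ φ (1 / (n : ℝ)) - φ (1 / ((n : ℝ) + 1)) := by
  have hn' : (1 : ℝ) ≤ n := by exact_mod_cast hn
  have hn0 : (0 : ℝ) < n := by linarith
  have key := hφ.secant_mono_aux1 (x := 0) (y := 1 / ((n : ℝ) + 1)) (z := 1 / (n : ℝ))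
    (by simp) ⟨by positivity, (div_le_one hn0).2 hn'⟩ (by positivity)
    (one_div_lt_one_div_of_lt hn0 (by linarith))
  rw [hφ0] at key
  generalize φ (1 / (n : ℝ)) = a at *
  generalize φ (1 / ((n : ℝ) + 1)) = b at *
  field_simp at key ⊢
  linarith

/-- If `φ` is convex on `[0,1]`, then the gaps `φ (1/n) - φ (1/(n+1))`, rescaled by the lengths
of the intervals `[1/(n+1), 1/n]`, are antitone in `n`. -/
theorem ConvexOn.mul_sub_inv_succ_le {φ : ℝ → ℝ} (hφ : ConvexOn ℝ (Set.Icc (0 : ℝ) 1) φ)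
    {n : ℕ} (hn : 1 ≤ n) :
    ((n : ℝ) + 2) * (φ (1 / ((n : ℝ) + 1)) - φ (1 / ((n : ℝ) + 2))) ≤
      n * (φ (1 / (n : ℝ)) - φ (1 / ((n : ℝ) + 1))) := by
  have hn' : (1 : ℝ) ≤ n := by exact_mod_cast hn
  have hn0 : (0 : ℝ) < n := by linarith
  have key := hφ.slope_mono_adjacent (x := 1 / ((n : ℝ) + 2)) (y := 1 / ((n : ℝ) + 1))
    (z := 1 / (n : ℝ))
    ⟨by positivity, (div_le_one (by positivity)).2 (by linarith)⟩
    ⟨by positivity, (div_le_one hn0).2 hn'⟩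
    (one_div_lt_one_div_of_lt (by positivity) (by linarith))
    (one_div_lt_one_div_of_lt hn0 (by linarith))
  have h₁ : 1 / ((n : ℝ) + 1) - 1 / ((n : ℝ) + 2) = 1 / (((n : ℝ) + 1) * (n + 2)) := by
    field_simp
    ring
  have h₂ : 1 / (n : ℝ) - 1 / ((n : ℝ) + 1) = 1 / (((n : ℝ) + 1) * n) := by
    field_simp
    ring
  rw [h₁, h₂, div_div_eq_mul_div, div_div_eq_mul_div, div_one, div_one] at key
  refine le_of_mul_le_mul_left ?_ (by positivity : (0 : ℝ) < n + 1)
  linarith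

/-- If `φ` is convex on `[0,1]` with `φ 0 = 0`, `λ_j = φ (1/j)` for `j ≥ 1`, and
`λ_j ≥ 0` for all `j ≥ 1`, then for all integers `1 ≤ j ≤ m` one has
`λ_j − λ_{j+1} ≥ λ_m − λ_{m+1} ≥ λ_m/(m+1) ≥ λ_m/(2m)`; in particular
`λ_j − λ_{j+1} ≥ λ_m/(2m)`. -/
theorem eigenvalue_gap_lower_bound_of_convex
    (φ : ℝ → ℝ) (hφ : ConvexOn ℝ (Set.Icc (0 : ℝ) 1) φ) (hφ0 : φ 0 = 0)
    (lam : ℕ → ℝ) (hlam : ∀ j : ℕ, 1 ≤ j → lam j = φ (1 / (j : ℝ)))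
    (hpos : ∀ j : ℕ, 1 ≤ j → 0 ≤ lam j)
    (j m : ℕ) (hj : 1 ≤ j) (hjm : j ≤ m) :
    lam m - lam (m + 1) ≤ lam j - lam (j + 1) ∧
    lam m / ((m : ℝ) + 1) ≤ lam m - lam (m + 1) ∧
    lam m / (2 * (m : ℝ)) ≤ lam m / ((m : ℝ) + 1) ∧
    lam m / (2 * (m : ℝ)) ≤ lam j - lam (j + 1) := by
  have gap : ∀ n : ℕ, 1 ≤ n → lam n / ((n : ℝ) + 1) ≤ lam n - lam (n + 1) := by
    intro n hn
    rw [hlam n hn, hlam (n + 1) (by omega)]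
    push_cast
    exact hφ.div_succ_le_sub_inv_succ hφ0 hn
  have step : ∀ n : ℕ, 1 ≤ n → lam (n + 1) - lam (n + 1 + 1) ≤ lam n - lam (n + 1) := by
    intro n hn
    have hn0 : (0 : ℝ) < n := by exact_mod_cast hn
    have hnonneg : 0 ≤ lam (n + 1) - lam (n + 1 + 1) :=
      (div_nonneg (hpos (n + 1) (by omega)) (by positivity)).trans (gap (n + 1) (by omega))
    have key : ((n : ℝ) + 2) * (lam (n + 1) - lam (n + 1 + 1)) ≤ n * (lam n - lam (n + 1)) := by
      rw [hlam n hn, hlam (n + 1) (by omega), hlam (n + 1 + 1) (by omega)]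
      push_cast
      rw [add_assoc (n : ℝ) 1 1, one_add_one_eq_two]
      exact hφ.mul_sub_inv_succ_le hn
    refine le_of_mul_le_mul_left ?_ hn0
    linarith
  have mono : lam m - lam (m + 1) ≤ lam j - lam (j + 1) := by
    induction m, hjm using Nat.le_induction with
    | base => exact le_rfl
    | succ n hn ih => exact (step n (hj.trans hn)).trans ih
  have hm : 1 ≤ m := hj.trans hjm
  have half : lam m / (2 * (m : ℝ)) ≤ lam m / ((m : ℝ) + 1) := by
    have hm' : (1 : ℝ) ≤ m := by exact_mod_cast hm
    exact div_le_div_of_nonneg_left (hpos m hm) (by positivity) (by linarith)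
  exact ⟨mono, gap m hm, half, half.trans ((gap m hm).trans mono)⟩
end

section
/- Let φ : ℝ → ℝ be convex on the interval [0,1] with φ(0) = 0, and for each integer j ≥ 1 set λ_j = φ(1/j); assume λ_m > 0 and λ_j > 0 for 1 ≤ j ≤ m. Then for every integer m ≥ 1, Σ_{j=1}^{m} λ_j^{-2} · j² · log j ≤ λ_m^{-2} · m³ · log m. -/
/-- A convex function vanishing at `0` contracts at least linearly along rays from `0`. -/
theorem ConvexOn.map_mul_le_of_map_zero {s : Set ℝ} {f : ℝ → ℝ} (hf : ConvexOn ℝ s f)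
    (h0 : (0 : ℝ) ∈ s) (hf0 : f 0 = 0) {x t : ℝ} (hx : x ∈ s) (ht0 : 0 ≤ t) (ht1 : t ≤ 1) :
    f (t * x) ≤ t * f x := by
  have h := hf.2 hx h0 ht0 (sub_nonneg.2 ht1) (add_sub_cancel t 1)
  simpa [hf0] using h

/-- If `φ` is convex on `[0,1]` with `φ 0 = 0`, `λ_j = φ (1/j)` for `j ≥ 1`, and
`λ_j > 0` for `1 ≤ j ≤ m` (in particular `λ_m > 0`), then for every integer `m ≥ 1`,
`Σ_{j=1}^m λ_j⁻² · j² · log j ≤ λ_m⁻² · m³ · log m`. -/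
theorem sum_inv_sq_eigenvalue_log_bound
    (φ : ℝ → ℝ) (hφ : ConvexOn ℝ (Set.Icc (0 : ℝ) 1) φ) (hφ0 : φ 0 = 0)
    (lam : ℕ → ℝ) (hlam : ∀ j : ℕ, 1 ≤ j → lam j = φ (1 / (j : ℝ)))
    (m : ℕ) (hm : 1 ≤ m)
    (hpos : ∀ j : ℕ, 1 ≤ j → j ≤ m → 0 < lam j) :
    ∑ j ∈ Finset.Icc 1 m, ((lam j)⁻¹) ^ 2 * (j : ℝ) ^ 2 * Real.log j ≤
      ((lam m)⁻¹) ^ 2 * (m : ℝ) ^ 3 * Real.log m := by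
  have hmpos : 0 < lam m := hpos m hm le_rfl
  have hterm : ∀ j ∈ Finset.Icc 1 m, ((lam j)⁻¹) ^ 2 * (j : ℝ) ^ 2 * Real.log j ≤
      ((lam m)⁻¹) ^ 2 * (m : ℝ) ^ 2 * Real.log m := by
    intro j hj
    obtain ⟨hj1, hjm⟩ := Finset.mem_Icc.1 hj
    have hjpos : 0 < lam j := hpos j hj1 hjm
    have hj1' : (1 : ℝ) ≤ j := by exact_mod_cast hj1
    have hjm' : (j : ℝ) ≤ m := by exact_mod_cast hjm
    have hj0 : (0 : ℝ) < j := by linarith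
    have hm0 : (0 : ℝ) < m := by linarith
    have hle1 : (j : ℝ) / m ≤ 1 := (div_le_one hm0).2 hjm'
    have hmem : 1 / (j : ℝ) ∈ Set.Icc (0 : ℝ) 1 := ⟨by positivity, (div_le_one hj0).2 hj1'⟩
    have hmul := hφ.map_mul_le_of_map_zero ⟨le_rfl, zero_le_one⟩ hφ0 hmem
      (by positivity : (0 : ℝ) ≤ j / m) hle1
    rw [show (j : ℝ) / m * (1 / j) = 1 / m by field_simp, ← hlam j hj1, ← hlam m hm] at hmul
    have hanti : lam m ≤ lam j := hmul.trans (mul_le_of_le_one_left hjpos.le hle1)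
    have hlog : 0 ≤ Real.log j := Real.log_nonneg hj1'
    gcongr
  calc ∑ j ∈ Finset.Icc 1 m, ((lam j)⁻¹) ^ 2 * (j : ℝ) ^ 2 * Real.log j
      ≤ ∑ _j ∈ Finset.Icc 1 m, ((lam m)⁻¹) ^ 2 * (m : ℝ) ^ 2 * Real.log m :=
        Finset.sum_le_sum hterm
    _ = ((lam m)⁻¹) ^ 2 * (m : ℝ) ^ 3 * Real.log m := by
        rw [Finset.sum_const, Nat.card_Icc, Nat.add_sub_cancel, nsmul_eq_mul]
        ring
end
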